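/- arXiv:0803.4171 — 2 statements merged into one kernel-verified Lean document; each statement's English description precedes it below -/
import Mathlib

section
/- Let ρ : ℝ → ℝ be an even Schwartz function with ∫_ℝ ρ(τ) dτ = 1, and define ρ₁(τ) := sign(τ)·∫_{|τ|}^∞ ρ(μ) dμ for τ ≠ 0 and ρ₁(0) := −1/2. Let (λ_j)_{j≥1} be a nondecreasing sequence of positive real numbers tending to +∞, let (c_j) be complex numbers, and suppose there exist K > 0 and a positive integer n such that Σ_{j : λ_j < λ} |c_j| ≤ K(1+λ)^n for all λ > 0. Define N(λ) := Σ_{j : λ_j < λ} c_j (so N(λ) = 0 for λ ≤ λ₁). Then for every λ ∈ ℝ, N(λ) − ∫_ℝ ρ(λ−μ) N(μ) dμ = Σ_j c_j ρ₁(λ − λ_j), where both the integral and the series converge absolutely. -/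
open MeasureTheory Real Filter

/-- A Schwartz function, reflected and translated, is integrable against a polynomial weight. -/
theorem SchwartzMap.integrable_norm_comp_sub_mul_one_add_abs_pow (ρ : SchwartzMap ℝ ℝ)
    (l : ℝ) (n : ℕ) : Integrable (fun μ : ℝ => ‖ρ (l - μ)‖ * (1 + |μ|) ^ n) := by
  have hcore : Integrable (fun t : ℝ => ‖ρ t‖ * (1 + |l - t|) ^ n) := by
    have h0 : Integrable (fun t : ℝ => ‖t‖ ^ n * ‖ρ t‖) := by
      simpa using ρ.integrable_pow_mul volume n
    refine ((ρ.integrable.norm.const_mul (2 ^ (n - 1) * (1 + |l|) ^ n)).add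
      (h0.const_mul (2 ^ (n - 1)))).mono' (by fun_prop) (ae_of_all _ fun t => ?_)
    have h1 : (1 + |l - t|) ^ n ≤ 2 ^ (n - 1) * ((1 + |l|) ^ n + |t| ^ n) :=
      (pow_le_pow_left₀ (by positivity) (by linarith [abs_sub l t]) n).trans
        (add_pow_le (by positivity) (abs_nonneg t) n)
    rw [Real.norm_of_nonneg (by positivity)]
    refine (mul_le_mul_of_nonneg_left h1 (norm_nonneg (ρ t))).trans (le_of_eq ?_)
    simp only [Pi.add_apply, Real.norm_eq_abs]
    ring
  simpa using hcore.comp_sub_left l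

/-- Below any level, a sequence tending to infinity has only finitely many terms. -/
theorem finite_setOf_lt_of_tendsto_atTop {u : ℕ → ℝ} (hu : Tendsto u atTop atTop) (l : ℝ) :
    {j : ℕ | u j < l}.Finite := by
  have h := hu.eventually_ge_atTop l
  rw [← Nat.cofinite_eq_atTop, eventually_cofinite] at h
  simpa using h

/-- The difference between a unit step and its convolution with an even function of integral one
is the odd primitive `ρ₁`. -/
theorem step_sub_setIntegral_Ioi_comp_sub {ρ ρ₁ : ℝ → ℝ} (hρ : Integrable ρ)
    (hρ_even : ∀ τ : ℝ, ρ (-τ) = ρ τ) (hρ_int : ∫ τ : ℝ, ρ τ = 1)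
    (hρ₁ : ∀ τ : ℝ, τ ≠ 0 → ρ₁ τ = Real.sign τ * ∫ μ in Set.Ioi |τ|, ρ μ)
    (hρ₁0 : ρ₁ 0 = -(1/2)) (l a : ℝ) :
    (if a < l then 1 else 0) - ∫ μ in Set.Ioi a, ρ (l - μ) = ρ₁ (l - a) := by
  have hIic (t : ℝ) : ∫ μ in Set.Iic t, ρ μ = ∫ μ in Set.Ioi (-t), ρ μ := by
    rw [← integral_comp_neg_Iic]
    simp [hρ_even]
  have hshift : ∫ μ in Set.Ioi a, ρ (l - μ) = ∫ μ in Set.Iic (l - a), ρ μ := by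
    have h := integral_comp_neg_Ioi (l - a) ρ
    rw [integral_Iic_eq_integral_Iio, ← integral_indicator measurableSet_Ioi,
      ← integral_indicator measurableSet_Iio,
      ← integral_sub_left_eq_self (Set.indicator (Set.Iio (l - a)) ρ) volume l]
    congr 1
    ext μ
    simp [Set.indicator_apply]
  have hsplit (t : ℝ) : ∫ μ in Set.Iic t, ρ μ = 1 - ∫ μ in Set.Ioi t, ρ μ := by
    rw [← hρ_int, ← intervalIntegral.integral_Iic_add_Ioi hρ.integrableOn hρ.integrableOn (b := t)]
    ring
  rw [hshift]
  rcases lt_trichotomy a l with h | rfl | h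
  · have hpos : 0 < l - a := sub_pos.2 h
    rw [hρ₁ _ hpos.ne', if_pos h, Real.sign_of_pos hpos, abs_of_pos hpos, hsplit]
    ring
  · have h1 := hsplit 0
    have h2 := hIic 0
    rw [neg_zero] at h2
    rw [if_neg (lt_irrefl a), sub_self, hρ₁0]
    linarith
  · have hneg : l - a < 0 := sub_neg.2 h
    rw [hρ₁ _ hneg.ne, if_neg h.not_gt, Real.sign_of_neg hneg, abs_of_neg hneg, hIic]
    ring

/-- For an even Schwartz function `ρ` with `∫ρ = 1`,
`ρ₁(τ) = sign(τ)·∫_{|τ|}^∞ ρ`, `ρ₁(0) = −1/2`, and a polynomially bounded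
spectral-type counting function `N(λ) = Σ_{λ_j < λ} c_j`, one has
`N(λ) − (ρ∗N)(λ) = Σ_j c_j ρ₁(λ − λ_j)`, with absolute convergence of both
the integral and the series. -/
theorem counting_function_convolution_identity
    (ρ : SchwartzMap ℝ ℝ)
    (hρ_even : ∀ τ : ℝ, ρ (-τ) = ρ τ)
    (hρ_int : ∫ τ : ℝ, ρ τ = 1)
    (ρ₁ : ℝ → ℝ)
    (hρ₁ : ∀ τ : ℝ, τ ≠ 0 → ρ₁ τ = Real.sign τ * ∫ μ in Set.Ioi |τ|, ρ μ)
    (hρ₁0 : ρ₁ 0 = -(1/2))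
    (lam : ℕ → ℝ) (hlam_mono : Monotone lam) (hlam_pos : ∀ j, 0 < lam j)
    (hlam_top : Tendsto lam atTop atTop)
    (c : ℕ → ℂ) (K : ℝ) (hK : 0 < K) (n : ℕ) (hn : 0 < n)
    (hbound : ∀ l : ℝ, 0 < l → ∑' j : {j : ℕ // lam j < l}, ‖c j.1‖ ≤ K * (1 + l) ^ n)
    (N : ℝ → ℂ) (hN : ∀ l : ℝ, N l = ∑' j : {j : ℕ // lam j < l}, c j.1) :
    ∀ l : ℝ,
      Integrable (fun μ : ℝ => (ρ (l - μ) : ℂ) * N μ) ∧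
      Summable (fun j : ℕ => c j * (ρ₁ (l - lam j) : ℂ)) ∧
      N l - ∫ μ : ℝ, (ρ (l - μ) : ℂ) * N μ = ∑' j : ℕ, c j * (ρ₁ (l - lam j) : ℂ) := by
  intro l
  have hsumm {E : Type} [NormedAddCommGroup E] (b : ℕ → E) (x : ℝ) :
      Summable fun j => if lam j < x then b j else 0 :=
    summable_of_hasFiniteSupport <|
      (finite_setOf_lt_of_tendsto_atTop hlam_top x).subset fun j hj => by
        by_contra hne
        exact hj (if_neg hne)
  have hNsum (x : ℝ) : HasSum (fun j => if lam j < x then c j else 0) (N x) := by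
    have h : N x = ∑' j, (if lam j < x then c j else 0) := by
      rw [hN x]
      exact tsum_subtype {j : ℕ | lam j < x} c
    rw [h]
    exact (hsumm c x).hasSum
  have hpartial (s : Finset ℕ) (x : ℝ) :
      ∑ j ∈ s, (if lam j < x then ‖c j‖ else 0) ≤ K * (1 + |x|) ^ n := by
    have hle : ∑ j ∈ s, (if lam j < x then ‖c j‖ else 0)
        ≤ ∑' j : {j : ℕ // lam j < x}, ‖c j.1‖ := by
      have h : ∑' j : {j : ℕ // lam j < x}, ‖c j.1‖
          = ∑' j, (if lam j < x then ‖c j‖ else 0) :=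
        tsum_subtype {j : ℕ | lam j < x} (fun j => ‖c j‖)
      rw [h]
      exact (hsumm (fun j => ‖c j‖) x).sum_le_tsum s fun j _ => by positivity
    rcases lt_or_ge 0 x with hx | hx
    · rw [abs_of_pos hx]
      exact hle.trans (hbound x hx)
    · rw [Finset.sum_eq_zero fun j _ => if_neg (not_lt.2 (hx.trans (hlam_pos j).le))]
      positivity
  have hW : Integrable (fun μ : ℝ => K * (‖ρ (l - μ)‖ * (1 + |μ|) ^ n)) :=
    (ρ.integrable_norm_comp_sub_mul_one_add_abs_pow l n).const_mul K
  have hρl : Integrable (fun μ : ℝ => ρ (l - μ)) := ρ.integrable.comp_sub_left l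
  let f : ℕ → ℝ → ℂ := fun j μ => (ρ (l - μ) : ℂ) * (if lam j < μ then c j else 0)
  have hf_eq (j : ℕ) :
      f j = (Set.Ioi (lam j)).indicator (fun μ => (ρ (l - μ) : ℂ) * c j) := by
    ext μ
    simp [f, Set.indicator_apply]
  have hf_int (j : ℕ) : Integrable (f j) := by
    rw [hf_eq]
    exact (hρl.ofReal.mul_const (c j)).indicator measurableSet_Ioi
  have hf_norm (j : ℕ) (μ : ℝ) :
      ‖f j μ‖ = ‖ρ (l - μ)‖ * (if lam j < μ then ‖c j‖ else 0) := by
    simp only [f]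
    split_ifs <;> simp
  have hf_partial (s : Finset ℕ) (μ : ℝ) :
      ∑ j ∈ s, ‖f j μ‖ ≤ K * (‖ρ (l - μ)‖ * (1 + |μ|) ^ n) := by
    simp only [hf_norm, ← Finset.mul_sum]
    exact (mul_le_mul_of_nonneg_left (hpartial s μ) (norm_nonneg _)).trans (le_of_eq (by ring))
  have hf_summable : Summable fun j => ∫ μ, ‖f j μ‖ := by
    refine summable_of_sum_le (c := ∫ μ, K * (‖ρ (l - μ)‖ * (1 + |μ|) ^ n))
      (fun j => integral_nonneg fun μ => norm_nonneg _) fun s => ?_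
    rw [← integral_finsetSum s fun j _ => (hf_int j).norm]
    exact integral_mono (integrable_finsetSum s fun j _ => (hf_int j).norm) hW (hf_partial s)
  have hf_hasSum (μ : ℝ) : HasSum (fun j => f j μ) ((ρ (l - μ) : ℂ) * N μ) :=
    (hNsum μ).mul_left _
  have hint : Integrable (fun μ : ℝ => (ρ (l - μ) : ℂ) * N μ) := by
    refine hW.mono' ?_ (ae_of_all _ fun μ => ?_)
    · exact aestronglyMeasurable_of_tendsto_ae atTop
        (f := fun (k : ℕ) μ => ∑ j ∈ Finset.range k, f j μ)
        (fun k => (integrable_finsetSum _ fun j _ => hf_int j).aestronglyMeasurable)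
        (ae_of_all _ fun μ => (hf_hasSum μ).tendsto_sum_nat)
    · exact le_of_tendsto (hf_hasSum μ).tendsto_sum_nat.norm
        (Eventually.of_forall fun k => (norm_sum_le _ _).trans (hf_partial _ μ))
  have hconv : HasSum (fun j => ∫ μ, f j μ) (∫ μ, (ρ (l - μ) : ℂ) * N μ) := by
    have h := hasSum_integral_of_summable_integral_norm hf_int hf_summable
    simpa only [(hf_hasSum _).tsum_eq] using h
  have hterm (j : ℕ) :
      (if lam j < l then c j else 0) - ∫ μ, f j μ = c j * (ρ₁ (l - lam j) : ℂ) := by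
    rw [← step_sub_setIntegral_Ioi_comp_sub ρ.integrable hρ_even hρ_int hρ₁ hρ₁0 l (lam j),
      hf_eq, integral_indicator measurableSet_Ioi, integral_mul_const, integral_complex_ofReal]
    split_ifs <;> push_cast <;> ring
  have hmain : HasSum (fun j => c j * (ρ₁ (l - lam j) : ℂ))
      (N l - ∫ μ : ℝ, (ρ (l - μ) : ℂ) * N μ) := by
    simpa only [hterm] using (hNsum l).sub hconv
  exact ⟨hint, hmain.summable, hmain.tsum_eq.symm⟩
end

section
/- Fix ρ, ρ₁, c and h₁ as in the context. Then: (i) for every t ∈ ℝ there exists a constant C (depending on t, ρ, c) such that |h₁(t+is, μ)| ≤ C μ^{−t} for all s ∈ ℝ and all μ > 2c; and (ii) for every t ∈ ℝ and all κ > 0, r > 0 there exists a constant C (depending on t, κ, r, ρ, c) such that |h₁(t+is, μ)| ≤ C μ^{−t−κ} ⟨s⟩^{κ} (1 + |ln⟨s⟩ − ln μ|)^{−r} for all s ∈ ℝ and all μ > 2c. -/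
open MeasureTheory Real Filter

/-- The coefficient `(-z)(-z-1)⋯(-z-k+1)` of the `k`-th derivative of `l ↦ l ^ (-z)`. -/
noncomputable def negCpowCoeff : ℕ → ℂ → ℂ
  | 0, _ => 1
  | k + 1, z => -z * negCpowCoeff k (z + 1)

/-- The Taylor polynomial of `l ↦ l ^ (-z)` at `μ` with `N` terms. -/
noncomputable def negCpowTaylor (N : ℕ) (z : ℂ) (μ l : ℝ) : ℂ :=
  ∑ k ∈ Finset.range N,
    negCpowCoeff k z / (k.factorial : ℂ) * (μ : ℂ) ^ (-z - k) * ((l - μ : ℝ) : ℂ) ^ k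

theorem hasDerivAt_ofReal_neg_cpow (z : ℂ) {l : ℝ} (hl : 0 < l) :
    HasDerivAt (fun x : ℝ => (x : ℂ) ^ (-z)) (-z * (l : ℂ) ^ (-z - 1)) l := by
  have h := (hasDerivAt_id (l : ℂ)).cpow_const (c := -z) (by simp [hl])
  simpa using h.comp_ofReal

theorem negCpowTaylor_succ (N : ℕ) (z : ℂ) (μ l : ℝ) :
    negCpowTaylor (N + 1) z μ l = (μ : ℂ) ^ (-z) + ∑ k ∈ Finset.range N,
      negCpowCoeff (k + 1) z / ((k + 1).factorial : ℂ) * (μ : ℂ) ^ (-z - (k + 1 : ℕ)) *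
        ((l - μ : ℝ) : ℂ) ^ (k + 1) := by
  rw [negCpowTaylor, Finset.sum_range_succ', add_comm]
  simp [negCpowCoeff]

theorem hasDerivAt_negCpowTaylor_succ (N : ℕ) (z : ℂ) (μ l : ℝ) :
    HasDerivAt (negCpowTaylor (N + 1) z μ) (-z * negCpowTaylor N (z + 1) μ l) l := by
  have hfun : negCpowTaylor (N + 1) z μ = fun l => (μ : ℂ) ^ (-z) + ∑ k ∈ Finset.range N,
      negCpowCoeff (k + 1) z / ((k + 1).factorial : ℂ) * (μ : ℂ) ^ (-z - (k + 1 : ℕ)) *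
        ((l - μ : ℝ) : ℂ) ^ (k + 1) := funext fun l => negCpowTaylor_succ N z μ l
  rw [hfun, negCpowTaylor, Finset.mul_sum]
  refine HasDerivAt.const_add _ (HasDerivAt.fun_sum fun k _ => ?_)
  have h1 : HasDerivAt (fun x : ℝ => ((x - μ : ℝ) : ℂ)) 1 l := by
    simpa using ((hasDerivAt_id l).sub_const μ).ofReal_comp
  refine ((h1.pow (k + 1)).const_mul _).congr_deriv ?_
  have hk : ((k.factorial : ℕ) : ℂ) ≠ 0 := by exact_mod_cast k.factorial_ne_zero
  have hk1 : (k : ℂ) + 1 ≠ 0 := by exact_mod_cast k.succ_ne_zero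
  have he : -z - ((k + 1 : ℕ) : ℂ) = -(z + 1) - k := by push_cast; ring
  rw [he, Nat.factorial_succ, negCpowCoeff]
  push_cast
  field_simp

theorem norm_cpow_sub_negCpowTaylor_le (N : ℕ) : ∀ (z : ℂ) {μ l B : ℝ}, 0 < μ → 0 < l →
    (∀ ξ ∈ Set.uIcc μ l, ξ ^ (-z.re - N) ≤ B) →
    ‖(l : ℂ) ^ (-z) - negCpowTaylor N z μ l‖ ≤ ‖negCpowCoeff N z‖ * |l - μ| ^ N * B := by
  induction N with
  | zero =>
    intro z μ l B hμ hl hB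
    simpa [negCpowTaylor, negCpowCoeff, Complex.norm_cpow_eq_rpow_re_of_pos hl]
      using hB l Set.right_mem_uIcc
  | succ N ih =>
    intro z μ l B hμ hl hB
    have hpos : ∀ ξ ∈ Set.uIcc μ l, 0 < ξ := fun ξ hξ =>
      (lt_min hμ hl).trans_le hξ.1
    have hB0 : 0 ≤ B := (rpow_nonneg hl.le _).trans (hB l Set.right_mem_uIcc)
    have hmvt := (convex_uIcc μ l).norm_image_sub_le_of_norm_hasDerivWithin_le
      (f := fun x : ℝ => (x : ℂ) ^ (-z) - negCpowTaylor (N + 1) z μ x)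
      (C := ‖negCpowCoeff (N + 1) z‖ * |l - μ| ^ N * B)
      (fun ξ hξ => ((hasDerivAt_ofReal_neg_cpow z (hpos ξ hξ)).sub
        (hasDerivAt_negCpowTaylor_succ N z μ ξ)).hasDerivWithinAt) ?_
      Set.left_mem_uIcc Set.right_mem_uIcc
    · have h0 : (μ : ℂ) ^ (-z) - negCpowTaylor (N + 1) z μ μ = 0 := by
        rw [negCpowTaylor_succ]; simp
      simp only [h0, sub_zero, Real.norm_eq_abs] at hmvt
      refine hmvt.trans_eq ?_
      ring
    · intro ξ hξ
      have hsub : Set.uIcc μ ξ ⊆ Set.uIcc μ l := Set.uIcc_subset_uIcc_left hξ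
      have h := ih (z + 1) hμ (hpos ξ hξ) (B := B) fun η hη => by
        have := hB η (hsub hη)
        convert this using 2
        simp; ring
      have hd : |ξ - μ| ≤ |l - μ| := Set.abs_sub_left_of_mem_uIcc hξ
      have he : -z - 1 = -(z + 1) := by ring
      rw [he, ← mul_sub, norm_mul, negCpowCoeff, norm_mul, mul_assoc, mul_assoc]
      refine mul_le_mul_of_nonneg_left (h.trans ?_) (norm_nonneg _)
      rw [mul_assoc]
      gcongr

theorem exists_norm_negCpowCoeff_le (k : ℕ) : ∀ t : ℝ, ∃ A : ℝ, 0 ≤ A ∧ ∀ s : ℝ,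
    ‖negCpowCoeff k ((t : ℂ) + (s : ℂ) * Complex.I)‖ ≤ A * √(1 + s ^ 2) ^ k := by
  induction k with
  | zero => exact fun t => ⟨1, zero_le_one, fun s => by simp [negCpowCoeff]⟩
  | succ k ih =>
    intro t
    obtain ⟨A, hA0, hA⟩ := ih (t + 1)
    refine ⟨(|t| + 1) * A, by positivity, fun s => ?_⟩
    have h1 : 1 ≤ √(1 + s ^ 2) := Real.one_le_sqrt.2 (by nlinarith)
    have h2 : |s| ≤ √(1 + s ^ 2) := Real.abs_le_sqrt (by nlinarith)
    have hz : ‖(t : ℂ) + (s : ℂ) * Complex.I‖ ≤ (|t| + 1) * √(1 + s ^ 2) := by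
      refine (norm_add_le _ _).trans ?_
      simp only [Complex.norm_real, norm_mul, Complex.norm_I, mul_one, Real.norm_eq_abs]
      nlinarith [abs_nonneg t]
    have hs := hA s
    have he : (t : ℂ) + (s : ℂ) * Complex.I + 1 = ((t + 1 : ℝ) : ℂ) + (s : ℂ) * Complex.I := by
      push_cast; ring
    rw [negCpowCoeff, norm_mul, norm_neg, he]
    calc _ ≤ (|t| + 1) * √(1 + s ^ 2) * (A * √(1 + s ^ 2) ^ k) := by gcongr
      _ = _ := by ring

/-- Peetre's inequality on `[c, ∞)`. -/
theorem rpow_le_rpow_mul_one_add_abs_sub_pow {c ξ μ p d : ℝ} {M : ℕ} (hc : 0 < c) (hξ : c ≤ ξ)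
    (hμ : c ≤ μ) (hM : |p| ≤ M) (hd : |ξ - μ| ≤ d) :
    ξ ^ p ≤ μ ^ p * ((1 + 1 / c) * (1 + d)) ^ M := by
  have hd0 : 0 ≤ d := (abs_nonneg _).trans hd
  have hξ0 := hc.trans_le hξ
  have hμ0 := hc.trans_le hμ
  set Q := (1 + 1 / c) * (1 + d) with hQ
  have hQ1 : 1 ≤ Q := by
    have : 0 < 1 / c := by positivity
    nlinarith
  have hQ0 : 0 < Q := by linarith
  have key : ∀ {x y : ℝ}, c ≤ y → x - y ≤ d → x ≤ y * Q := by
    intro x y hy hxy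
    have h1 : 1 ≤ y * (1 / c) := by rw [mul_one_div, le_div_iff₀ hc]; linarith
    have : y * Q = y + y * d + y * (1 / c) + y * (1 / c) * d := by rw [hQ]; ring
    nlinarith [mul_nonneg (hc.le.trans hy) hd0]
  have hQM : Q ^ |p| ≤ Q ^ M := by
    rw [← Real.rpow_natCast]
    exact Real.rpow_le_rpow_of_exponent_le hQ1 hM
  have hμp : 0 ≤ μ ^ p := rpow_nonneg hμ0.le _
  refine le_trans ?_ (mul_le_mul_of_nonneg_left hQM hμp)
  rcases le_total 0 p with hp | hp
  · rw [abs_of_nonneg hp, ← Real.mul_rpow hμ0.le hQ0.le]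
    exact Real.rpow_le_rpow hξ0.le (key hμ ((le_abs_self _).trans hd)) hp
  · rw [abs_of_nonpos hp, Real.rpow_neg hQ0.le, ← div_eq_mul_inv, ← Real.div_rpow hμ0.le hQ0.le]
    refine Real.rpow_le_rpow_of_nonpos (by positivity) ?_ hp
    rw [div_le_iff₀ hQ0]
    exact key hξ (by linarith [neg_abs_le (ξ - μ)])

theorem exists_norm_negCpowTaylor_sub_le (N : ℕ) (t : ℝ) {c : ℝ} (hc : 0 < c) :
    ∃ (B : ℝ) (M : ℕ), 0 ≤ B ∧ ∀ s μ l : ℝ, 2 * c < μ →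
      ‖negCpowTaylor N ((t : ℂ) + (s : ℂ) * Complex.I) μ l -
          ((max l c : ℝ) : ℂ) ^ (-((t : ℂ) + (s : ℂ) * Complex.I))‖ ≤
        B * (√(1 + s ^ 2) ^ N * μ ^ (-t - N)) * (1 + |l - μ|) ^ M := by
  choose A hA0 hA using fun k => exists_norm_negCpowCoeff_le k t
  obtain ⟨m, hm⟩ := exists_nat_ge |-t - (N : ℝ)|
  set K := 1 + 1 / c with hK
  have hK0 : 0 ≤ K := by positivity
  refine ⟨A N * K ^ m + (∑ k ∈ Finset.range N, A k * 2 ^ N + c ^ N * K ^ m), m + N,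
    by have := hA0 N; have : 0 ≤ ∑ k ∈ Finset.range N, A k * 2 ^ N :=
        Finset.sum_nonneg fun k _ => mul_nonneg (hA0 k) (by positivity)
       positivity, fun s μ l hμ => ?_⟩
  have hSum : 0 ≤ ∑ k ∈ Finset.range N, A k * 2 ^ N :=
    Finset.sum_nonneg fun k _ => mul_nonneg (hA0 k) (by positivity)
  have hAN := hA0 N
  have hμ0 : 0 < μ := by linarith
  set z : ℂ := (t : ℂ) + (s : ℂ) * Complex.I with hz
  have hre : z.re = t := by simp [hz]
  set J := √(1 + s ^ 2) with hJ
  have h1 : 1 ≤ J := Real.one_le_sqrt.2 (by nlinarith)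
  have hJN : 1 ≤ J ^ N := one_le_pow₀ h1
  set d := |l - μ| with hd
  have hd0 : 0 ≤ d := abs_nonneg _
  have hp0 : 0 < μ ^ (-t - (N : ℝ)) := rpow_pos_of_pos hμ0 _
  set p := μ ^ (-t - (N : ℝ)) with hp
  have hdN : (1 + d) ^ N ≤ (1 + d) ^ (m + N) := pow_le_pow_right₀ (by linarith) (by omega)
  have hdm : (1 + d) ^ m ≤ (1 + d) ^ (m + N) := pow_le_pow_right₀ (by linarith) (by omega)
  rcases lt_or_ge c l with hl | hl
  · rw [max_eq_left hl.le, norm_sub_rev]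
    have h := norm_cpow_sub_negCpowTaylor_le N z hμ0 (hc.trans hl)
      (B := p * (K * (1 + d)) ^ m) fun ξ hξ => by
        rw [hre]
        refine rpow_le_rpow_mul_one_add_abs_sub_pow hc ?_ (by linarith) hm
          (Set.abs_sub_left_of_mem_uIcc hξ)
        exact (le_min (by linarith) hl.le).trans hξ.1
    refine h.trans ?_
    calc _ ≤ (A N * J ^ N) * (1 + d) ^ N * (p * (K * (1 + d)) ^ m) := by
          gcongr
          · exact hA N s
          · linarith
      _ = A N * K ^ m * (J ^ N * p) * (1 + d) ^ (m + N) := by rw [mul_pow, pow_add]; ring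
      _ ≤ _ := by
          gcongr
          have : 0 ≤ c ^ N * K ^ m := by positivity
          linarith
  · rw [max_eq_right hl]
    have hdμ : μ ≤ 2 * d := by
      rw [hd, abs_sub_comm]
      linarith [le_abs_self (μ - l)]
    have hT : ‖negCpowTaylor N z μ l‖ ≤
        (∑ k ∈ Finset.range N, A k * 2 ^ N) * (J ^ N * p) * (1 + d) ^ (m + N) := by
      rw [negCpowTaylor, Finset.sum_mul, Finset.sum_mul]
      refine norm_sum_le_of_le _ fun k hk => ?_
      have hkN : k ≤ N := (Finset.mem_range.1 hk).le
      have hfac : ‖negCpowCoeff k z / (k.factorial : ℂ)‖ ≤ A k * J ^ N := by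
        rw [norm_div, Complex.norm_natCast]
        refine (div_le_self (norm_nonneg _) (by exact_mod_cast k.factorial_pos)).trans ?_
        refine (hA k s).trans ?_
        have := hA0 k
        have := pow_le_pow_right₀ h1 hkN
        gcongr
      have hpow : ‖(μ : ℂ) ^ (-z - k)‖ = p * μ ^ (N - k) := by
        rw [Complex.norm_cpow_eq_rpow_re_of_pos hμ0, hp, ← Real.rpow_natCast μ (N - k),
          ← Real.rpow_add hμ0, Nat.cast_sub hkN]
        congr 1
        simp [hre]
      have hdk : ‖((l - μ : ℝ) : ℂ) ^ k‖ = d ^ k := by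
        rw [norm_pow, Complex.norm_real, Real.norm_eq_abs]
      rw [norm_mul, norm_mul, hpow, hdk]
      have h3 : μ ^ (N - k) * d ^ k ≤ 2 ^ N * (1 + d) ^ (m + N) := by
        calc μ ^ (N - k) * d ^ k ≤ (2 * d) ^ (N - k) * (2 * d) ^ k := by gcongr; linarith
          _ = 2 ^ N * d ^ N := by rw [← pow_add, Nat.sub_add_cancel hkN, mul_pow]
          _ ≤ 2 ^ N * (1 + d) ^ N := by gcongr; linarith
          _ ≤ _ := by gcongr
      calc _ ≤ A k * J ^ N * (p * μ ^ (N - k)) * d ^ k := by gcongr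
        _ = A k * J ^ N * p * (μ ^ (N - k) * d ^ k) := by ring
        _ ≤ A k * J ^ N * p * (2 ^ N * (1 + d) ^ (m + N)) := by
            have := hA0 k
            gcongr
        _ = _ := by ring
    have hC : ‖(c : ℂ) ^ (-z)‖ ≤ c ^ N * K ^ m * (J ^ N * p) * (1 + d) ^ (m + N) := by
      have hpe := rpow_le_rpow_mul_one_add_abs_sub_pow hc le_rfl (by linarith) hm
        (d := d) (ξ := c) (μ := μ) (by
          rw [hd, abs_sub_comm c, abs_sub_comm l, abs_of_nonneg (by linarith),
            abs_of_nonneg (by linarith)]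
          linarith)
      rw [Complex.norm_cpow_eq_rpow_re_of_pos hc]
      calc c ^ (-z).re = c ^ N * c ^ (-t - (N : ℝ)) := by
            rw [← Real.rpow_natCast c N, ← Real.rpow_add hc]
            congr 1
            simp [hre]
        _ ≤ c ^ N * (p * (K * (1 + d)) ^ m) := by gcongr
        _ = c ^ N * K ^ m * (1 * p) * (1 + d) ^ m := by rw [mul_pow]; ring
        _ ≤ _ := by gcongr
    refine (norm_sub_le _ _).trans ((add_le_add hT hC).trans ?_)
    have : 0 ≤ A N * K ^ m * (J ^ N * p) * (1 + d) ^ (m + N) := by positivity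
    linarith

theorem SchwartzMap.integrable_one_add_abs_pow_mul (ρ : SchwartzMap ℝ ℝ) (M : ℕ) :
    Integrable fun x : ℝ => (1 + |x|) ^ M * |ρ x| := by
  have h : (fun x : ℝ => (1 + |x|) ^ M * |ρ x|) = fun x =>
      ∑ m ∈ Finset.range (M + 1), (M.choose m : ℝ) * (‖x‖ ^ m * ‖ρ x‖) := by
    ext x
    rw [add_comm, add_pow, Finset.sum_mul]
    refine Finset.sum_congr rfl fun m _ => ?_
    simp only [Real.norm_eq_abs]
    ring
  rw [h]
  exact integrable_finsetSum _ fun m _ => (ρ.integrable_pow_mul volume m).const_mul _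

theorem SchwartzMap.integrable_ofReal_pow_mul (ρ : SchwartzMap ℝ ℝ) (k : ℕ) :
    Integrable fun x : ℝ => (x : ℂ) ^ k * (ρ x : ℂ) := by
  refine (ρ.integrable_pow_mul volume k).mono'
    (Continuous.aestronglyMeasurable (by have := ρ.continuous; fun_prop)) ?_
  filter_upwards with x
  simp

theorem SchwartzMap.integral_ofReal_eq_one {ρ : SchwartzMap ℝ ℝ}
    (h : ∃ δ : ℝ, 0 < δ ∧ ∀ ξ : ℝ, |ξ| < δ →
      (∫ τ : ℝ, (ρ τ : ℂ) * Complex.exp (-(Complex.I * (τ : ℂ) * (ξ : ℂ)))) = 1) :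
    ∫ τ : ℝ, (ρ τ : ℂ) = 1 := by
  obtain ⟨δ, hδ, h⟩ := h
  simpa using h 0 (by simpa using hδ)

theorem SchwartzMap.integral_pow_mul_eq_zero {ρ : SchwartzMap ℝ ℝ}
    (h : ∃ δ : ℝ, 0 < δ ∧ ∀ ξ : ℝ, |ξ| < δ →
      (∫ τ : ℝ, (ρ τ : ℂ) * Complex.exp (-(Complex.I * (τ : ℂ) * (ξ : ℂ)))) = 1)
    {k : ℕ} (hk : k ≠ 0) : ∫ τ : ℝ, (τ : ℂ) ^ k * (ρ τ : ℂ) = 0 := by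
  obtain ⟨δ, hδ, h⟩ := h
  have hev : FourierTransform.fourier (fun τ : ℝ => (ρ τ : ℂ)) =ᶠ[nhds 0] fun _ => (1 : ℂ) := by
    filter_upwards [Metric.ball_mem_nhds (0 : ℝ) (ε := δ / (2 * π)) (by positivity)] with w hw
    rw [Real.fourier_eq', ← h (2 * π * w) ?_]
    · refine integral_congr_ae (Eventually.of_forall fun τ => ?_)
      simp only [smul_eq_mul, mul_comm (ρ τ : ℂ)]
      congr 2
      simp
      ring
    · rw [abs_mul, abs_of_pos (by positivity : 0 < 2 * π)]
      rw [Metric.mem_ball, dist_zero_right, Real.norm_eq_abs, lt_div_iff₀ (by positivity)] at hw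
      linarith
  have hd := hev.iteratedDeriv_eq k
  rw [iteratedDeriv_const, if_neg hk, Real.iteratedDeriv_fourier (N := ⊤)
    (fun n _ => by simpa [Complex.real_smul] using ρ.integrable_ofReal_pow_mul n) le_top,
    Real.fourier_eq'] at hd
  have hd' : ∫ τ : ℝ, (-2 * π * Complex.I) ^ k * ((τ : ℂ) ^ k * (ρ τ : ℂ)) = 0 := by
    refine Eq.trans (integral_congr_ae (Eventually.of_forall fun τ => ?_)) hd
    rw [mul_pow (-2 * π * Complex.I : ℂ)]
    simp [mul_assoc]
  rw [integral_const_mul] at hd'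
  refine (mul_eq_zero.1 hd').resolve_left (pow_ne_zero _ ?_)
  simp [Real.pi_ne_zero]

theorem integrable_negCpowTaylor_mul (ρ : SchwartzMap ℝ ℝ) (N : ℕ) (z : ℂ) (μ : ℝ) :
    Integrable fun l : ℝ => negCpowTaylor N z μ l * (ρ (l - μ) : ℂ) := by
  simp only [negCpowTaylor, Finset.sum_mul, mul_assoc]
  refine integrable_finsetSum _ fun k _ => ((Integrable.const_mul ?_ _).const_mul _)
  exact (ρ.integrable_ofReal_pow_mul k).comp_sub_right μ

theorem integral_negCpowTaylor_succ_mul {ρ : SchwartzMap ℝ ℝ}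
    (h0 : ∫ τ : ℝ, (ρ τ : ℂ) = 1)
    (h : ∀ k : ℕ, k ≠ 0 → ∫ τ : ℝ, (τ : ℂ) ^ k * (ρ τ : ℂ) = 0) (N : ℕ) (z : ℂ) (μ : ℝ) :
    ∫ l : ℝ, negCpowTaylor (N + 1) z μ l * (ρ (l - μ) : ℂ) = (μ : ℂ) ^ (-z) := by
  simp only [negCpowTaylor, Finset.sum_mul]
  have hint : ∀ k : ℕ, Integrable fun l : ℝ => ((l - μ : ℝ) : ℂ) ^ k * (ρ (l - μ) : ℂ) :=
    fun k => (ρ.integrable_ofReal_pow_mul k).comp_sub_right μ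
  have hmom : ∀ k : ℕ, ∫ l : ℝ, ((l - μ : ℝ) : ℂ) ^ k * (ρ (l - μ) : ℂ) =
      ∫ τ : ℝ, (τ : ℂ) ^ k * (ρ τ : ℂ) := fun k =>
    integral_sub_right_eq_self (fun τ : ℝ => (τ : ℂ) ^ k * (ρ τ : ℂ)) μ
  simp only [mul_assoc]
  rw [integral_finsetSum _ fun k _ => (((hint k).const_mul _).const_mul _)]
  simp only [integral_const_mul, hmom]
  rw [Finset.sum_range_succ', Finset.sum_eq_zero fun k _ => by rw [h _ k.succ_ne_zero]; simp]
  simp [h0, negCpowCoeff]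

theorem SchwartzMap.hasDerivAt_integral_Ioi (ρ : SchwartzMap ℝ ℝ) (x : ℝ) :
    HasDerivAt (fun y : ℝ => ∫ τ in Set.Ioi y, ρ τ) (-ρ x) x := by
  have hint := ρ.integrable (μ := volume)
  have he : (fun y : ℝ => ∫ τ in Set.Ioi y, ρ τ) =
      fun y => (∫ τ in Set.Ioi 0, ρ τ) - ∫ τ in (0 : ℝ)..y, ρ τ := by
    ext y
    rw [← intervalIntegral.integral_interval_add_Ioi (a := 0) (b := y) hint.integrableOn
      hint.integrableOn]
    ring
  rw [he]
  exact (intervalIntegral.integral_hasDerivAt_right hint.intervalIntegrable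
    (ρ.continuous.stronglyMeasurableAtFilter _ _) ρ.continuous.continuousAt).const_sub _

theorem SchwartzMap.exists_abs_integral_Ioi_mul_pow_le (ρ : SchwartzMap ℝ ℝ) (L : ℕ) :
    ∃ C : ℝ, ∀ x : ℝ, 0 ≤ x → |∫ τ in Set.Ioi x, ρ τ| * x ^ L ≤ C := by
  refine ⟨∫ τ : ℝ, ‖τ‖ ^ L * ‖ρ τ‖, fun x hx => ?_⟩
  have hint := ρ.integrable_pow_mul volume L
  calc |∫ τ in Set.Ioi x, ρ τ| * x ^ L ≤ (∫ τ in Set.Ioi x, ‖ρ τ‖) * x ^ L := by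
        gcongr
        exact norm_integral_le_integral_norm (fun τ => ρ τ)
    _ = ∫ τ in Set.Ioi x, x ^ L * ‖ρ τ‖ := by rw [integral_const_mul, mul_comm]
    _ ≤ ∫ τ in Set.Ioi x, ‖τ‖ ^ L * ‖ρ τ‖ := by
        refine setIntegral_mono_on ((ρ.integrable (μ := volume)).norm.integrableOn.const_mul _)
          hint.integrableOn measurableSet_Ioi fun τ hτ => ?_
        have h1 : x ≤ ‖τ‖ := (le_of_lt hτ).trans (le_abs_self τ)
        gcongr
    _ ≤ _ := setIntegral_le_integral hint (Eventually.of_forall fun τ => by positivity)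

theorem integrable_max_cpow_mul (ρ : SchwartzMap ℝ ℝ) {c : ℝ} (hc : 0 < c) (z : ℂ) {μ : ℝ}
    (hμ : 2 * c < μ) :
    Integrable fun l : ℝ => ((max l c : ℝ) : ℂ) ^ (-z) * (ρ (l - μ) : ℂ) := by
  obtain ⟨B, M, hB, h⟩ := exists_norm_negCpowTaylor_sub_le 0 z.re hc
  refine (((ρ.integrable_one_add_abs_pow_mul M).comp_sub_right μ).const_mul
    (B * (√(1 + z.im ^ 2) ^ 0 * μ ^ (-z.re - (0 : ℕ))))).mono'
    (Continuous.aestronglyMeasurable ?_) (Eventually.of_forall fun l => ?_)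
  · refine Continuous.mul (continuous_iff_continuousAt.2 fun l => ?_)
      (by have := ρ.continuous; fun_prop)
    exact (Complex.continuousAt_ofReal_cpow_const _ _
      (Or.inr (hc.trans_le (le_max_right l c)).ne')).comp (f := fun l => max l c) (by fun_prop)
  · have := h z.im μ l hμ
    rw [Complex.re_add_im, negCpowTaylor, Finset.sum_range_zero, zero_sub, norm_neg] at this
    rw [norm_mul, Complex.norm_real, Real.norm_eq_abs, ← mul_assoc]
    gcongr

theorem SchwartzMap.isBigO_cpow_mul_integral_Ioi (ρ : SchwartzMap ℝ ℝ) (z : ℂ) (μ : ℝ) :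
    (fun l : ℝ => (l : ℂ) ^ (-z) * ((∫ τ in Set.Ioi (l - μ), ρ τ : ℝ) : ℂ)) =O[atTop]
      fun l : ℝ => l ^ (-2 : ℝ) := by
  obtain ⟨L, hL⟩ := exists_nat_ge (2 - z.re)
  obtain ⟨C, hC⟩ := ρ.exists_abs_integral_Ioi_mul_pow_le L
  refine Asymptotics.IsBigO.of_bound (2 ^ L * C) ?_
  filter_upwards [eventually_ge_atTop 1, eventually_ge_atTop (2 * μ)] with l hl1 hl2
  have hl0 : 0 < l := by linarith
  have h1 := hC (l - μ) (by linarith)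
  have h2 : |∫ τ in Set.Ioi (l - μ), ρ τ| * (l / 2) ^ L ≤ C := le_trans (by gcongr; linarith) h1
  have hC0 : 0 ≤ C := le_trans (by positivity) h2
  rw [norm_mul, Complex.norm_cpow_eq_rpow_re_of_pos hl0, Complex.norm_real, Real.norm_eq_abs,
    Real.norm_eq_abs, abs_of_pos (rpow_pos_of_pos hl0 _)]
  have h3 : |∫ τ in Set.Ioi (l - μ), ρ τ| ≤ 2 ^ L * C * l ^ (-(L : ℝ)) := by
    rw [Real.rpow_neg hl0.le, Real.rpow_natCast, ← div_eq_mul_inv, le_div_iff₀ (by positivity)]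
    rw [div_pow] at h2
    calc _ = 2 ^ L * (|∫ τ in Set.Ioi (l - μ), ρ τ| * (l ^ L / 2 ^ L)) := by field_simp
      _ ≤ _ := by gcongr
  calc _ ≤ l ^ (-z).re * (2 ^ L * C * l ^ (-(L : ℝ))) := by gcongr
    _ = 2 ^ L * C * l ^ ((-z).re + -(L : ℝ)) := by rw [Real.rpow_add hl0]; ring
    _ ≤ _ := by
      gcongr
      simp only [Complex.neg_re]
      linarith

theorem SchwartzMap.integrableOn_cpow_mul_integral_Ioi (ρ : SchwartzMap ℝ ℝ) (z : ℂ) (μ : ℝ)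
    {c : ℝ} (hc : 0 < c) :
    IntegrableOn (fun l : ℝ => (l : ℂ) ^ (-z) * ((∫ τ in Set.Ioi (l - μ), ρ τ : ℝ) : ℂ))
      (Set.Ioi c) := by
  refine IntegrableOn.mono_set (t := Set.Ici c) ?_ Set.Ioi_subset_Ici_self
  refine LocallyIntegrableOn.integrableOn_of_isBigO_atTop
    (ContinuousOn.locallyIntegrableOn (fun l hl => ?_) measurableSet_Ici)
    (ρ.isBigO_cpow_mul_integral_Ioi z μ)
    ⟨Set.Ioi 1, Ioi_mem_atTop 1, integrableOn_Ioi_rpow_of_lt (by norm_num) one_pos⟩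
  refine ContinuousAt.continuousWithinAt (ContinuousAt.mul
    (Complex.continuousAt_ofReal_cpow_const _ _ (Or.inr (hc.trans_le hl).ne')) ?_)
  exact Complex.continuous_ofReal.continuousAt.comp
    ((ρ.hasDerivAt_integral_Ioi (l - μ)).continuousAt.comp (f := fun l : ℝ => l - μ)
      (by fun_prop))

/-- Integration by parts: the derivative of the truncated step is `δ₀ - ρ`. -/
theorem mul_integral_cpow_mul_eq {ρ : SchwartzMap ℝ ℝ} (hρ_even : ∀ τ : ℝ, ρ (-τ) = ρ τ)
    (h0 : ∫ τ : ℝ, (ρ τ : ℂ) = 1) {ρ₁ : ℝ → ℝ}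
    (hρ₁ : ∀ τ : ℝ, τ ≠ 0 → ρ₁ τ = Real.sign τ * ∫ μ in Set.Ioi |τ|, ρ μ)
    {c : ℝ} (hc : 0 < c) (z : ℂ) {μ : ℝ} (hμ : 2 * c < μ) :
    z * ∫ l in Set.Ioi c, (l : ℂ) ^ (-z - 1) * (ρ₁ (l - μ) : ℂ) =
      (μ : ℂ) ^ (-z) - ∫ l : ℝ, ((max l c : ℝ) : ℂ) ^ (-z) * (ρ (l - μ) : ℂ) := by
  have hcμ : c ≤ μ := by linarith
  set Ψ : ℝ → ℝ := fun y => ∫ τ in Set.Ioi y, ρ τ with hΨ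
  have hint := ρ.integrable (μ := volume)
  have h0' : ∫ τ : ℝ, ρ τ = 1 := by
    rw [integral_complex_ofReal] at h0; exact_mod_cast h0
  have hIic : ∀ y, ∫ τ in Set.Iic y, ρ τ = 1 - Ψ y := fun y => by
    rw [← h0', ← intervalIntegral.integral_Iic_add_Ioi (b := y) hint.integrableOn
      hint.integrableOn]
    simp [hΨ]
  have hpos : ∀ τ, 0 < τ → ρ₁ τ = Ψ τ := fun τ hτ => by
    rw [hρ₁ τ hτ.ne', Real.sign_of_pos hτ, abs_of_pos hτ, one_mul]
  have hneg : ∀ τ, τ < 0 → ρ₁ τ = Ψ τ - 1 := fun τ hτ => by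
    rw [hρ₁ τ hτ.ne, Real.sign_of_neg hτ, abs_of_neg hτ, ← integral_comp_neg_Iic]
    simp only [hρ_even, hIic]
    ring
  have hi1 : IntegrableOn (fun l : ℝ => (l : ℂ) ^ (-z - 1) * (Ψ (l - μ) : ℂ)) (Set.Ioi c) := by
    rw [show -z - 1 = -(z + 1) by ring]
    exact ρ.integrableOn_cpow_mul_integral_Ioi (z + 1) μ hc
  have himax := integrable_max_cpow_mul ρ hc z hμ
  have hi2 : IntegrableOn (fun l : ℝ => (l : ℂ) ^ (-z) * (ρ (l - μ) : ℂ)) (Set.Ioi c) :=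
    himax.integrableOn.congr_fun (fun l hl => by
      simp only [max_eq_left (le_of_lt (Set.mem_Ioi.1 hl))]) measurableSet_Ioi
  have hderiv : ∀ l ∈ Set.Ici c, HasDerivAt (fun l : ℝ => (l : ℂ) ^ (-z) * (Ψ (l - μ) : ℂ))
      (-z * ((l : ℂ) ^ (-z - 1) * (Ψ (l - μ) : ℂ)) - (l : ℂ) ^ (-z) * (ρ (l - μ) : ℂ)) l := by
    intro l hl
    have h1 : HasDerivAt (fun l : ℝ => Ψ (l - μ)) (-ρ (l - μ)) l :=
      (ρ.hasDerivAt_integral_Ioi (l - μ)).comp_sub_const l μ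
    refine ((hasDerivAt_ofReal_neg_cpow z (hc.trans_le hl)).mul h1.ofReal_comp).congr_deriv ?_
    push_cast
    ring
  have hlim : Tendsto (fun l : ℝ => (l : ℂ) ^ (-z) * (Ψ (l - μ) : ℂ)) atTop (nhds 0) :=
    (ρ.isBigO_cpow_mul_integral_Ioi z μ).trans_tendsto (tendsto_rpow_neg_atTop two_pos)
  have hA := integral_Ioi_of_hasDerivAt_of_tendsto' hderiv ((hi1.const_mul (-z)).sub hi2) hlim
  rw [integral_sub (hi1.const_mul (-z)) hi2, integral_const_mul] at hA
  have hB : z * ∫ l in Set.Ioc c μ, (l : ℂ) ^ (-z - 1) = (c : ℂ) ^ (-z) - (μ : ℂ) ^ (-z) := by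
    have hmem : ∀ l ∈ Set.uIcc c μ, 0 < l := fun l hl => by
      rw [Set.uIcc_of_le hcμ] at hl; exact hc.trans_le hl.1
    have h := intervalIntegral.integral_eq_sub_of_hasDerivAt
      (fun l hl => hasDerivAt_ofReal_neg_cpow z (hmem l hl))
      (ContinuousOn.intervalIntegrable fun l hl => (continuousAt_const.mul
        (Complex.continuousAt_ofReal_cpow_const l _
          (Or.inr (hmem l hl).ne'))).continuousWithinAt)
    rw [intervalIntegral.integral_const_mul, intervalIntegral.integral_of_le hcμ] at h
    linear_combination -h
  have hi3 : IntegrableOn (fun l : ℝ => (l : ℂ) ^ (-z - 1)) (Set.Ioc c μ) := by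
    rw [← intervalIntegrable_iff_integrableOn_Ioc_of_le hcμ]
    refine ContinuousOn.intervalIntegrable fun l hl => ?_
    rw [Set.uIcc_of_le hcμ] at hl
    exact (Complex.continuousAt_ofReal_cpow_const l _
      (Or.inr (hc.trans_le hl.1).ne')).continuousWithinAt
  have hsplit : ∫ l in Set.Ioi c, (l : ℂ) ^ (-z - 1) * (ρ₁ (l - μ) : ℂ) =
      (∫ l in Set.Ioi c, (l : ℂ) ^ (-z - 1) * (Ψ (l - μ) : ℂ)) -
        ∫ l in Set.Ioc c μ, (l : ℂ) ^ (-z - 1) := by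
    have hi4 := (integrable_indicator_iff measurableSet_Ioc).2 hi3
    have h5 : ∫ l in Set.Ioc c μ, (l : ℂ) ^ (-z - 1) = ∫ l in Set.Ioi c,
        (Set.Ioc c μ).indicator (fun l : ℝ => (l : ℂ) ^ (-z - 1)) l := by
      rw [setIntegral_indicator measurableSet_Ioc,
        Set.inter_eq_self_of_subset_right Set.Ioc_subset_Ioi_self]
    rw [h5, ← integral_sub hi1 hi4.integrableOn]
    refine setIntegral_congr_ae measurableSet_Ioi ?_
    filter_upwards [Measure.ae_ne volume μ] with l hlμ hl
    rcases lt_or_gt_of_ne hlμ with h | h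
    · have hm : l ∈ Set.Ioc c μ := ⟨hl, h.le⟩
      rw [Set.indicator_of_mem hm, hneg _ (by linarith)]
      push_cast
      ring
    · rw [Set.indicator_of_notMem (fun hm => absurd hm.2 (not_le.2 h)), hpos _ (by linarith),
        sub_zero]
  have hC : ∫ l : ℝ, ((max l c : ℝ) : ℂ) ^ (-z) * (ρ (l - μ) : ℂ) =
      (c : ℂ) ^ (-z) * (1 - (Ψ (c - μ) : ℂ)) +
        ∫ l in Set.Ioi c, (l : ℂ) ^ (-z) * (ρ (l - μ) : ℂ) := by
    rw [← intervalIntegral.integral_Iic_add_Ioi (b := c) himax.integrableOn himax.integrableOn]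
    congr 1
    · rw [setIntegral_congr_fun measurableSet_Iic (g := fun l : ℝ =>
        (c : ℂ) ^ (-z) * (ρ (l - μ) : ℂ)) (fun l hl => by
          simp only [max_eq_right (Set.mem_Iic.1 hl)]), integral_const_mul,
        integral_complex_ofReal]
      congr 1
      have := hIic (c - μ)
      have hs : ∫ l in Set.Iic c, ρ (l - μ) = ∫ τ in Set.Iic (c - μ), ρ τ := by
        rw [← integral_indicator measurableSet_Iic, ← integral_indicator measurableSet_Iic,
          ← integral_sub_right_eq_self ((Set.Iic (c - μ)).indicator fun τ => ρ τ) μ]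
        congr 1
        ext l
        simp [Set.indicator]
      rw [hs, this]
      push_cast
      ring
    · refine setIntegral_congr_fun measurableSet_Ioi fun l hl => ?_
      simp only [max_eq_left (le_of_lt (Set.mem_Ioi.1 hl))]
  rw [hsplit, mul_sub, hB, hC]
  linear_combination -hA

theorem norm_integral_mul_schwartz_le {ρ : SchwartzMap ℝ ℝ} {f : ℝ → ℂ} {B μ : ℝ} {M : ℕ}
    (hf : ∀ l : ℝ, ‖f l‖ ≤ B * (1 + |l - μ|) ^ M) :
    ‖∫ l : ℝ, f l * (ρ (l - μ) : ℂ)‖ ≤ B * ∫ x : ℝ, (1 + |x|) ^ M * |ρ x| := by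
  rw [← integral_sub_right_eq_self (fun x : ℝ => (1 + |x|) ^ M * |ρ x|) μ, ← integral_const_mul]
  refine norm_integral_le_of_norm_le
    (((ρ.integrable_one_add_abs_pow_mul M).comp_sub_right μ).const_mul _)
    (Eventually.of_forall fun l => ?_)
  rw [norm_mul, Complex.norm_real, Real.norm_eq_abs, ← mul_assoc]
  exact mul_le_mul_of_nonneg_right (hf l) (abs_nonneg _)

/-- Logarithmic powers are absorbed by interpolating between the powers `0` and `N`. -/
theorem exists_exp_min_le {κ r : ℝ} {N : ℕ} (hκ : 0 < κ) (hr : 0 < r) (hN : κ < N) :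
    ∃ D : ℝ, ∀ y : ℝ, min 1 (rexp (N * y)) ≤ D * rexp (κ * y) * (1 + |y|) ^ (-r) := by
  obtain ⟨a, ha0, haκ, haN⟩ : ∃ a : ℝ, 0 < a ∧ a ≤ κ ∧ a ≤ N - κ :=
    ⟨min κ (N - κ), lt_min hκ (by linarith), min_le_left _ _, min_le_right _ _⟩
  set m := max 1 (r / a) with hm
  have hm1 : 1 ≤ m := le_max_left _ _
  have hm2 : r / a ≤ m := le_max_right _ _
  refine ⟨m ^ r, fun y => ?_⟩
  have hy := abs_nonneg y
  have h1 : 1 + |y| ≤ m * rexp (a / r * |y|) := by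
    have h2 := Real.add_one_le_exp (a / r * |y|)
    have h3 : 1 ≤ m * (a / r) := by
      calc 1 = r / a * (a / r) := by field_simp
        _ ≤ _ := by gcongr
    nlinarith [mul_le_mul_of_nonneg_left h2 (zero_le_one.trans hm1),
      mul_le_mul_of_nonneg_right h3 hy]
  have h2 : (1 + |y|) ^ r ≤ m ^ r * rexp (a * |y|) := by
    refine (Real.rpow_le_rpow (by positivity) h1 hr.le).trans_eq ?_
    rw [Real.mul_rpow (by positivity) (Real.exp_pos _).le, ← Real.exp_mul]
    congr 2
    field_simp
  rw [Real.rpow_neg (by positivity), ← div_eq_mul_inv, le_div_iff₀ (by positivity)]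
  have h3 : min 1 (rexp (N * y)) ≤ rexp (κ * y - a * |y|) := by
    rcases le_total 0 y with h | h
    · refine (min_le_left _ _).trans (Real.one_le_exp ?_)
      rw [abs_of_nonneg h]
      nlinarith
    · refine (min_le_right _ _).trans (Real.exp_le_exp.2 ?_)
      rw [abs_of_nonpos h]
      nlinarith
  calc _ ≤ rexp (κ * y - a * |y|) * (m ^ r * rexp (a * |y|)) := by gcongr
    _ = m ^ r * rexp (κ * y - a * |y| + a * |y|) := by rw [Real.exp_add]; ring
    _ = _ := by rw [sub_add_cancel]

/-- Estimates for the auxiliary function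
`h₁(z,μ) = z ∫_c^∞ λ^{−z−1} ρ₁(λ−μ) dλ`:
(i) `|h₁(t+is,μ)| ≤ C μ^{−t}`, and
(ii) `|h₁(t+is,μ)| ≤ C μ^{−t−κ} ⟨s⟩^κ (1+|ln⟨s⟩−ln μ|)^{−r}` for all `κ, r > 0`,
uniformly for `s ∈ ℝ` and `μ > 2c`. -/
theorem h1_estimates
    (ρ : SchwartzMap ℝ ℝ)
    (hρ_even : ∀ τ : ℝ, ρ (-τ) = ρ τ)
    (hρhat_supp : HasCompactSupport fun ξ : ℝ =>
      ∫ τ : ℝ, (ρ τ : ℂ) * Complex.exp (-(Complex.I * (τ : ℂ) * (ξ : ℂ))))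
    (hρhat_one : ∃ δ : ℝ, 0 < δ ∧ ∀ ξ : ℝ, |ξ| < δ →
      (∫ τ : ℝ, (ρ τ : ℂ) * Complex.exp (-(Complex.I * (τ : ℂ) * (ξ : ℂ)))) = 1)
    (ρ₁ : ℝ → ℝ)
    (hρ₁ : ∀ τ : ℝ, τ ≠ 0 → ρ₁ τ = Real.sign τ * ∫ μ in Set.Ioi |τ|, ρ μ)
    (hρ₁0 : ρ₁ 0 = -(1/2))
    (c : ℝ) (hc : 0 < c)
    (h1 : ℂ → ℝ → ℂ)
    (hh1 : ∀ z : ℂ, ∀ μ : ℝ,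
      h1 z μ = z * ∫ l in Set.Ioi c, (l : ℂ) ^ (-z - 1) * (ρ₁ (l - μ) : ℂ))
    (t : ℝ) :
    (∃ C : ℝ, ∀ s μ : ℝ, 2 * c < μ →
      ‖h1 ((t : ℂ) + (s : ℂ) * Complex.I) μ‖ ≤ C * μ ^ (-t)) ∧
    (∀ κ r : ℝ, 0 < κ → 0 < r → ∃ C : ℝ, ∀ s μ : ℝ, 2 * c < μ →
      ‖h1 ((t : ℂ) + (s : ℂ) * Complex.I) μ‖ ≤
        C * μ ^ (-t - κ) * Real.sqrt (1 + s ^ 2) ^ κ *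
          (1 + |Real.log (Real.sqrt (1 + s ^ 2)) - Real.log μ|) ^ (-r)) := by
  have h0 := SchwartzMap.integral_ofReal_eq_one hρhat_one
  have hmom : ∀ k : ℕ, k ≠ 0 → ∫ τ : ℝ, (τ : ℂ) ^ k * (ρ τ : ℂ) = 0 := fun k hk =>
    SchwartzMap.integral_pow_mul_eq_zero hρhat_one hk
  have hrep : ∀ (N : ℕ) (z : ℂ) (μ : ℝ), 2 * c < μ → h1 z μ =
      ∫ l : ℝ, (negCpowTaylor (N + 1) z μ l - ((max l c : ℝ) : ℂ) ^ (-z)) *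
        (ρ (l - μ) : ℂ) := fun N z μ hμ => by
    rw [hh1, mul_integral_cpow_mul_eq hρ_even h0 hρ₁ hc z hμ,
      ← integral_negCpowTaylor_succ_mul h0 hmom N z μ,
      ← integral_sub (integrable_negCpowTaylor_mul ρ (N + 1) z μ)
        (integrable_max_cpow_mul ρ hc z hμ)]
    simp only [sub_mul]
  have hI0 : ∀ M : ℕ, 0 ≤ ∫ x : ℝ, (1 + |x|) ^ M * |ρ x| := fun M =>
    integral_nonneg fun x => by positivity
  have hbound : ∃ C : ℝ, 0 ≤ C ∧ ∀ s μ : ℝ, 2 * c < μ →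
      ‖h1 ((t : ℂ) + (s : ℂ) * Complex.I) μ‖ ≤ C * μ ^ (-t) := by
    obtain ⟨B, M, hB0, hB⟩ := exists_norm_negCpowTaylor_sub_le 0 t hc
    refine ⟨(1 + B) * ∫ x : ℝ, (1 + |x|) ^ M * |ρ x|,
      mul_nonneg (by positivity) (hI0 M), fun s μ hμ => ?_⟩
    have hμ0 : 0 < μ := by linarith
    rw [hrep 0 _ μ hμ]
    refine (norm_integral_mul_schwartz_le (B := (1 + B) * μ ^ (-t)) (M := M)
      fun l => ?_).trans_eq (by ring)
    have h := hB s μ l hμ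
    simp only [negCpowTaylor, Finset.sum_range_zero, zero_sub, norm_neg, pow_zero, one_mul,
      Nat.cast_zero, sub_zero] at h
    refine (norm_sub_le _ _).trans ((add_le_add_right h _).trans ?_)
    have h2 : ‖negCpowTaylor (0 + 1) ((t : ℂ) + (s : ℂ) * Complex.I) μ l‖ = μ ^ (-t) := by
      rw [negCpowTaylor_succ, Finset.sum_range_zero, add_zero,
        Complex.norm_cpow_eq_rpow_re_of_pos hμ0]
      simp
    have h3 : 1 ≤ (1 + |l - μ|) ^ M := one_le_pow₀ (by linarith [abs_nonneg (l - μ)])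
    rw [h2]
    nlinarith [mul_le_mul_of_nonneg_left h3 (rpow_nonneg hμ0.le (-t))]
  obtain ⟨C₀, hC₀0, hC₀⟩ := hbound
  refine ⟨⟨C₀, hC₀⟩, fun κ r hκ hr => ?_⟩
  obtain ⟨n, hn⟩ := exists_nat_gt κ
  have hnκ : κ < ((n + 1 : ℕ) : ℝ) := by push_cast; linarith
  obtain ⟨D, hD⟩ := exists_exp_min_le hκ hr hnκ
  obtain ⟨B, M, hB0, hB⟩ := exists_norm_negCpowTaylor_sub_le (n + 1) t hc
  set C₁ := B * ∫ x : ℝ, (1 + |x|) ^ M * |ρ x| with hC₁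
  have hC₁0 : 0 ≤ C₁ := mul_nonneg hB0 (hI0 M)
  refine ⟨(C₀ + C₁) * D, fun s μ hμ => ?_⟩
  have hμ0 : 0 < μ := by linarith
  set J := √(1 + s ^ 2) with hJ
  have hJ0 : 0 < J := Real.sqrt_pos.2 (by positivity)
  have hlow := hC₀ s μ hμ
  have hhigh : ‖h1 ((t : ℂ) + (s : ℂ) * Complex.I) μ‖ ≤
      C₁ * (J ^ (n + 1) * μ ^ (-t - ((n + 1 : ℕ) : ℝ))) := by
    rw [hrep n _ μ hμ]
    exact (norm_integral_mul_schwartz_le fun l => hB s μ l hμ).trans_eq (by rw [hC₁]; ring)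
  set y := Real.log J - Real.log μ with hy
  have hexp : ∀ a : ℝ, rexp (a * y) = J ^ a * μ ^ (-a) := fun a => by
    rw [Real.rpow_def_of_pos hJ0, Real.rpow_def_of_pos hμ0, ← Real.exp_add, hy]
    congr 1
    ring
  have hμt : 0 ≤ μ ^ (-t) := rpow_nonneg hμ0.le _
  have hmin : ‖h1 ((t : ℂ) + (s : ℂ) * Complex.I) μ‖ ≤
      (C₀ + C₁) * μ ^ (-t) * min 1 (rexp (((n + 1 : ℕ) : ℝ) * y)) := by
    rw [sub_eq_add_neg, Real.rpow_add hμ0, ← Real.rpow_natCast J] at hhigh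
    rcases min_choice 1 (rexp (((n + 1 : ℕ) : ℝ) * y)) with h | h
    · rw [h]
      nlinarith [mul_nonneg hC₁0 hμt]
    · rw [h]
      have h5 : 0 ≤ C₀ * (μ ^ (-t) * rexp (((n + 1 : ℕ) : ℝ) * y)) := by positivity
      rw [hexp] at h5 ⊢
      linarith
  calc _ ≤ (C₀ + C₁) * μ ^ (-t) * (D * rexp (κ * y) * (1 + |y|) ^ (-r)) :=
        hmin.trans (mul_le_mul_of_nonneg_left (hD y) (by positivity))
    _ = _ := by
        rw [hexp, sub_eq_add_neg (-t), Real.rpow_add hμ0]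
        ring
end
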